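/- arXiv:1506.00090 — 2 statements merged into one kernel-verified Lean document; each statement's English description precedes it below -/
import Mathlib

section
/- An L-structure A is equational Artinian if and only if for every natural number n, every subset of At_L(x₁,…,xₙ) is compact in the radical topology with respect to A. -/
open FirstOrder

/-- The solution set in `A` of a system `S` of equations in `n` variables. -/
def VSet (L : FirstOrder.Language) (A : Type*) [L.Structure A] {n : ℕ}
    (S : Set (L.Term (Fin n) × L.Term (Fin n))) : Set (Fin n → A) :=
  { a | ∀ pq ∈ S, pq.1.realize a = pq.2.realize a }

/-- A subset of `Aⁿ` is an algebraic set if it is the solution set of some system. -/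
def IsAlgebraicSet (L : FirstOrder.Language) (A : Type*) [L.Structure A] {n : ℕ}
    (Y : Set (Fin n → A)) : Prop :=
  ∃ S, Y = VSet L A S

/-- The radical of a subset `E ⊆ Aⁿ`. -/
def Rad (L : FirstOrder.Language) (A : Type*) [L.Structure A] {n : ℕ}
    (E : Set (Fin n → A)) : Set (L.Term (Fin n) × L.Term (Fin n)) :=
  { pq | ∀ a ∈ E, pq.1.realize a = pq.2.realize a }

/-- An `A`-radical ideal of the term algebra. -/
def IsRadicalIdeal (L : FirstOrder.Language) (A : Type*) [L.Structure A] {n : ℕ}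
    (R : Set (L.Term (Fin n) × L.Term (Fin n))) : Prop :=
  ∃ E : Set (Fin n → A), R = Rad L A E

/-- `A` is equational Artinian: every ascending chain of algebraic sets stabilizes. -/
def EquationalArtinian (L : FirstOrder.Language) (A : Type*) [L.Structure A] : Prop :=
  ∀ (n : ℕ) (Y : ℕ → Set (Fin n → A)),
    (∀ i, IsAlgebraicSet L A (Y i)) → (∀ i, Y i ⊆ Y (i + 1)) →
    ∃ N, ∀ m, N ≤ m → Y m = Y N

/-- The radical topology on atomic formulas: closed sets are arbitrary intersections of
finite unions of `A`-radical ideals. -/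
def radicalTopology (L : FirstOrder.Language) (A : Type*) [L.Structure A] (n : ℕ) :
    TopologicalSpace (L.Term (Fin n) × L.Term (Fin n)) :=
  TopologicalSpace.generateFrom { U | IsRadicalIdeal L A Uᶜ }

/-- The Zariski topology on `Aⁿ`: closed sets are arbitrary intersections of
finite unions of algebraic sets. -/
def zariskiTopology (L : FirstOrder.Language) (A : Type*) [L.Structure A] (n : ℕ) :
    TopologicalSpace (Fin n → A) :=
  TopologicalSpace.generateFrom { U | IsAlgebraicSet L A Uᶜ }

section

variable {L : FirstOrder.Language} {A : Type*} [L.Structure A] {n : ℕ}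

theorem vSet_antitone : Antitone (VSet L A (n := n)) :=
  fun _ _ h _ ha pq hpq => ha pq (h hpq)

theorem rad_antitone : Antitone (Rad L A (n := n)) :=
  fun _ _ h _ hpq a ha => hpq a (h ha)

theorem subset_rad_vSet (S : Set (L.Term (Fin n) × L.Term (Fin n))) :
    S ⊆ Rad L A (VSet L A S) :=
  fun pq hpq _ ha => ha pq hpq

theorem subset_vSet_rad (E : Set (Fin n → A)) : E ⊆ VSet L A (Rad L A E) :=
  fun a ha _ hpq => hpq a ha

theorem IsAlgebraicSet.vSet_rad {Y : Set (Fin n → A)} (hY : IsAlgebraicSet L A Y) :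
    VSet L A (Rad L A Y) = Y := by
  obtain ⟨S, rfl⟩ := hY
  exact (vSet_antitone (subset_rad_vSet S)).antisymm (subset_vSet_rad _)

theorem IsRadicalIdeal.rad_vSet {R : Set (L.Term (Fin n) × L.Term (Fin n))}
    (hR : IsRadicalIdeal L A R) : Rad L A (VSet L A R) = R := by
  obtain ⟨E, rfl⟩ := hR
  exact (rad_antitone (subset_vSet_rad E)).antisymm (subset_rad_vSet _)

/-- Intersections of radical ideals, phrased through complements, are fixed by `Rad ∘ VSet`. -/
theorem rad_vSet_compl_sUnion {Q : Set (Set (L.Term (Fin n) × L.Term (Fin n)))}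
    (hQ : ∀ U ∈ Q, IsRadicalIdeal L A Uᶜ) :
    Rad L A (VSet L A (⋃₀ Q)ᶜ) = (⋃₀ Q)ᶜ := by
  refine Set.Subset.antisymm ?_ (subset_rad_vSet _)
  rintro pq hpq ⟨U, hU, hpU⟩
  have hle : (⋃₀ Q)ᶜ ⊆ Uᶜ := Set.compl_subset_compl.2 (Set.subset_sUnion_of_mem hU)
  have hmem := rad_antitone (vSet_antitone hle) hpq
  rw [(hQ U hU).rad_vSet] at hmem
  exact hmem hpU

theorem EquationalArtinian.wellFoundedGT (h : EquationalArtinian L A) (n : ℕ) :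
    WellFoundedGT {Y : Set (Fin n → A) // IsAlgebraicSet L A Y} := by
  refine wellFoundedGT_iff_monotone_chain_condition.2 fun a => ?_
  obtain ⟨N, hN⟩ := h n (fun i => (a i).1) (fun i => (a i).2) fun i => a.mono i.le_succ
  exact ⟨N, fun m hm => Subtype.ext (hN m hm).symm⟩

theorem EquationalArtinian.isCompact (h : EquationalArtinian L A)
    (S : Set (L.Term (Fin n) × L.Term (Fin n))) :
    @IsCompact _ (radicalTopology L A n) S := by
  let _ := radicalTopology L A n
  refine isCompact_generateFrom rfl fun P hP hSP => ?_
  have := h.wellFoundedGT n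
  obtain ⟨_, ⟨Q, hQP, hQ, rfl⟩, hmax⟩ := (wellFounded_gt
    (α := {Y : Set (Fin n → A) // IsAlgebraicSet L A Y})).has_min
    {Y | ∃ Q ⊆ P, Q.Finite ∧ (⟨VSet L A (⋃₀ Q)ᶜ, _, rfl⟩ : Subtype _) = Y}
    ⟨_, ∅, Set.empty_subset P, Set.finite_empty, rfl⟩
  refine ⟨Q, hQP, hQ, hSP.trans (Set.sUnion_subset fun U hU => ?_)⟩
  have hUQ : insert U Q ⊆ P := Set.insert_subset hU hQP
  have hle : VSet L A (⋃₀ Q)ᶜ ⊆ VSet L A (⋃₀ insert U Q)ᶜ :=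
    vSet_antitone (Set.compl_subset_compl.2 (Set.sUnion_mono (Set.subset_insert U Q)))
  have heq : VSet L A (⋃₀ Q)ᶜ = VSet L A (⋃₀ insert U Q)ᶜ := by
    by_contra hne
    exact hmax _ ⟨insert U Q, hUQ, hQ.insert U, rfl⟩ (hle.ssubset_of_ne hne)
  have hrad := congrArg (Rad L A) heq
  rw [rad_vSet_compl_sUnion fun V hV => hP (hQP hV),
    rad_vSet_compl_sUnion fun V hV => hP (hUQ hV), compl_inj_iff] at hrad
  rw [hrad]
  exact Set.subset_sUnion_of_mem (Set.mem_insert U Q)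

theorem equationalArtinian_of_isCompact
    (h : ∀ (n : ℕ) (S : Set (L.Term (Fin n) × L.Term (Fin n))),
      @IsCompact _ (radicalTopology L A n) S) :
    EquationalArtinian L A := by
  intro n Y hY hmono
  let _ := radicalTopology L A n
  have hYmono : Monotone Y := monotone_nat_of_le_succ hmono
  have hUmono : Monotone fun i => (Rad L A (Y i))ᶜ :=
    fun _ _ hij => Set.compl_subset_compl.2 (rad_antitone (hYmono hij))
  obtain ⟨N, hN⟩ := (h n (⋃ i, (Rad L A (Y i))ᶜ)).elim_directed_cover
    (fun i => (Rad L A (Y i))ᶜ)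
    (fun i => TopologicalSpace.isOpen_generateFrom_of_mem ⟨Y i, compl_compl _⟩)
    subset_rfl hUmono.directed_le
  refine ⟨N, fun m hm => Set.Subset.antisymm ?_ (hYmono hm)⟩
  have hle : Rad L A (Y N) ⊆ Rad L A (Y m) :=
    Set.compl_subset_compl.1 ((Set.subset_iUnion (fun i => (Rad L A (Y i))ᶜ) m).trans hN)
  rw [← (hY m).vSet_rad, ← (hY N).vSet_rad]
  exact vSet_antitone hle

end

/-- `A` is equational Artinian iff for every `n`, every subset of
`At_L(x₁,…,xₙ)` is compact in the radical topology with respect to `A`. -/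
theorem equationalArtinian_iff_radicalTopology_subsets_compact
    {L : FirstOrder.Language} (A : Type*) [L.Structure A]
    (hL : ∀ k, IsEmpty (L.Relations k)) :
    EquationalArtinian L A ↔
      ∀ (n : ℕ) (S : Set (L.Term (Fin n) × L.Term (Fin n))),
        @IsCompact _ (radicalTopology L A n) S :=
  ⟨fun h _ S => h.isCompact S, equationalArtinian_of_isCompact⟩
end

section
/- Let A be an equational Artinian L-structure and let B be an L-structure that is fully residually A, i.e., for every finite set F of pairs (b,b′) of distinct elements of B there exists an L-homomorphism φ : B → A with φ(b) ≠ φ(b′) for all (b,b′) ∈ F. Then B is equational Artinian. -/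
open FirstOrder

/-- The solution set is antitone in the system of equations. -/
theorem VSet_anti {L : FirstOrder.Language} {A : Type*} [L.Structure A] {n : ℕ}
    {S T : Set (L.Term (Fin n) × L.Term (Fin n))} (h : S ⊆ T) : VSet L A T ⊆ VSet L A S :=
  fun _ ha pq hpq => ha pq (h hpq)

/-- The radical is antitone in the set of points. -/
theorem Rad_anti {L : FirstOrder.Language} {A : Type*} [L.Structure A] {n : ℕ}
    {E F : Set (Fin n → A)} (h : E ⊆ F) : Rad L A F ⊆ Rad L A E :=
  fun _ hpq a ha => hpq a (h ha)

/-- Every set of points lies in its algebraic closure. -/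
theorem subset_VSet_Rad {L : FirstOrder.Language} {A : Type*} [L.Structure A] {n : ℕ}
    (E : Set (Fin n → A)) : E ⊆ VSet L A (Rad L A E) :=
  fun a ha _ hpq => hpq a ha

/-- The set of all images in `Aⁿ` of points of `Y ⊆ Bⁿ` under homomorphisms `B → A`. -/
def homImages (L : FirstOrder.Language) (A : Type*) {B : Type*} [L.Structure A] [L.Structure B]
    {n : ℕ} (Y : Set (Fin n → B)) : Set (Fin n → A) :=
  { a | ∃ φ : B →[L] A, ∃ b ∈ Y, a = φ ∘ b }

theorem homImages_mono {L : FirstOrder.Language} {A B : Type*} [L.Structure A] [L.Structure B]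
    {n : ℕ} {Y Z : Set (Fin n → B)} (h : Y ⊆ Z) : homImages L A Y ⊆ homImages L A Z :=
  fun _ ⟨φ, b, hb, ha⟩ => ⟨φ, b, h hb, ha⟩

/-- Homomorphic images of solutions of a system are again solutions. -/
theorem subset_Rad_homImages_VSet {L : FirstOrder.Language} {A B : Type*} [L.Structure A]
    [L.Structure B] {n : ℕ} (S : Set (L.Term (Fin n) × L.Term (Fin n))) :
    S ⊆ Rad L A (homImages L A (VSet L B S)) := by
  rintro pq hpq _ ⟨φ, b, hb, rfl⟩
  rw [FirstOrder.Language.HomClass.realize_term, FirstOrder.Language.HomClass.realize_term,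
    hb pq hpq]

/-- every fully residually `A` structure is equational Artinian when `A`
is. -/
theorem equationalArtinian_of_fullyResidually
    {L : FirstOrder.Language} (A B : Type*) [L.Structure A] [L.Structure B]
    (hL : ∀ k, IsEmpty (L.Relations k))
    (hA : EquationalArtinian L A)
    (hres : ∀ F : Finset (B × B), (∀ p ∈ F, p.1 ≠ p.2) →
      ∃ φ : B →[L] A, ∀ p ∈ F, φ p.1 ≠ φ p.2) :
    EquationalArtinian L B := by
  intro n Y hY hmono
  obtain ⟨N, hN⟩ := hA n (fun i => VSet L A (Rad L A (homImages L A (Y i))))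
    (fun i => ⟨_, rfl⟩) (fun i => VSet_anti (Rad_anti (homImages_mono (hmono i))))
  refine ⟨N, fun m hm => Set.Subset.antisymm ?_ (monotone_nat_of_le_succ hmono hm)⟩
  intro b hb
  obtain ⟨S, hS⟩ := hY N
  rw [hS]
  intro pq hpq
  by_contra hne
  obtain ⟨φ, hφ⟩ := hres {(pq.1.realize b, pq.2.realize b)} (by simpa using hne)
  have hmem : φ ∘ b ∈ VSet L A (Rad L A (homImages L A (Y N))) :=
    hN m hm ▸ subset_VSet_Rad _ ⟨φ, b, hb, rfl⟩
  have heq := hmem pq (by rw [hS]; exact subset_Rad_homImages_VSet S hpq)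
  rw [FirstOrder.Language.HomClass.realize_term,
    FirstOrder.Language.HomClass.realize_term] at heq
  exact hφ _ (Finset.mem_singleton_self _) heq
end
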